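/- For every real ε with 0 < ε ≤ 1/2, the total flux integral Φ(ε) := Σ_{σ∈{+1,−1}} (1/√2)·∫₀^{2π} max(0, σ·√(2ε) − √(1 − 2ε)·cos α) dα satisfies: Φ(ε) = 4·(√(1/2 − 2ε) + √ε · arcsin √(ε/(1/2 − ε))) when 0 < ε < 1/4, and Φ(ε) = 2π√ε when 1/4 ≤ ε ≤ 1/2. -/

import Mathlib

open MeasureTheory Real

/-- The total flux `Φ(ε)` of the invariant measure through the ball-piston
collision surface, summed over the two signs `σ = ±1` of the piston velocity. -/
noncomputable def totalFlux (ε : ℝ) : ℝ :=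
  (1/Real.sqrt 2) * (∫ α in (0:ℝ)..(2*Real.pi),
      max 0 (Real.sqrt (2*ε) - Real.sqrt (1 - 2*ε) * Real.cos α))
  + (1/Real.sqrt 2) * (∫ α in (0:ℝ)..(2*Real.pi),
      max 0 (-Real.sqrt (2*ε) - Real.sqrt (1 - 2*ε) * Real.cos α))


lemma flux_aux (b t : ℝ) (hb : 0 ≤ b) (h0 : 0 ≤ t) (hp : t ≤ π) :
    ∫ α in (0:ℝ)..(2*Real.pi), max 0 (b * Real.cos t - b * Real.cos α)
      = b * (Real.cos t * (2*π - 2*t) + 2 * Real.sin t) := by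
  have hc : Continuous fun α : ℝ => max 0 (b * Real.cos t - b * Real.cos α) := by fun_prop
  have hi : ∀ x y : ℝ, IntervalIntegrable (fun α : ℝ => max 0 (b * Real.cos t - b * Real.cos α)) volume x y :=
    fun x y => hc.intervalIntegrable x y
  rw [← intervalIntegral.integral_add_adjacent_intervals (hi 0 t) (hi t (2*π)),
    ← intervalIntegral.integral_add_adjacent_intervals (hi t (2*π - t)) (hi (2*π-t) (2*π))]
  have e1 : ∫ α in (0:ℝ)..t, max 0 (b * Real.cos t - b * Real.cos α) = ∫ α in (0:ℝ)..t, (0:ℝ) := by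
    apply intervalIntegral.integral_congr
    intro x hx
    rw [Set.uIcc_of_le h0] at hx
    have := Real.cos_le_cos_of_nonneg_of_le_pi hx.1 hp hx.2
    exact max_eq_left (by nlinarith)
  have e3 : ∫ α in (2*π-t)..(2*π), max 0 (b * Real.cos t - b * Real.cos α)
      = ∫ α in (2*π-t)..(2*π), (0:ℝ) := by
    apply intervalIntegral.integral_congr
    intro x hx
    rw [Set.uIcc_of_le (by linarith)] at hx
    have := Real.cos_le_cos_of_nonneg_of_le_pi (x := 2*π - x) (y := t)
      (by linarith [hx.2]) hp (by linarith [hx.1])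
    rw [Real.cos_two_pi_sub] at this
    exact max_eq_left (by nlinarith)
  have e2 : ∫ α in t..(2*π-t), max 0 (b * Real.cos t - b * Real.cos α)
      = ∫ α in t..(2*π-t), (b * Real.cos t - b * Real.cos α) := by
    apply intervalIntegral.integral_congr
    intro x hx
    rw [Set.uIcc_of_le (by linarith)] at hx
    have : Real.cos x ≤ Real.cos t := by
      rcases le_total x π with h | h
      · exact Real.cos_le_cos_of_nonneg_of_le_pi h0 h hx.1
      · rw [← Real.cos_two_pi_sub x]
        exact Real.cos_le_cos_of_nonneg_of_le_pi h0 (by linarith) (by linarith [hx.2])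
    exact max_eq_right (by nlinarith)
  rw [e1, e2, e3, intervalIntegral.integral_sub (by simp)
    ((by fun_prop : Continuous fun α : ℝ => b * Real.cos α).intervalIntegrable _ _)]
  simp [Real.sin_two_pi_sub]
  ring

theorem stmt_10 (ε : ℝ) (h1 : 0 < ε) (h2 : ε ≤ 1/2) :
    (ε < 1/4 →
      totalFlux ε =
        4 * (Real.sqrt (1/2 - 2*ε)
          + Real.sqrt ε * Real.arcsin (Real.sqrt (ε/(1/2 - ε))))) ∧
    (1/4 ≤ ε → totalFlux ε = 2 * Real.pi * Real.sqrt ε) := by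
  have s2 : (0:ℝ) < √2 := by positivity
  have ha : √(2*ε) = √2 * √ε := Real.sqrt_mul (by norm_num) ε
  constructor
  · intro h
    have hb : 0 < √(1 - 2*ε) := Real.sqrt_pos.2 (by linarith)
    have hq : √(ε/(1/2 - ε)) = √(2*ε) / √(1 - 2*ε) := by
      rw [← Real.sqrt_div (by linarith)]
      congr 1
      have : 1/2 - ε ≠ 0 := by linarith
      have : 1 - 2*ε ≠ 0 := by linarith
      field_simp
    have hq0 : 0 ≤ √(ε/(1/2 - ε)) := Real.sqrt_nonneg _
    have hq1 : √(ε/(1/2 - ε)) ≤ 1 := by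
      rw [Real.sqrt_le_one, div_le_one (by linarith)]; linarith
    set q := √(ε/(1/2 - ε)) with hqd
    have hab : √(2*ε) = √(1 - 2*ε) * Real.cos (Real.arccos q) := by
      rw [Real.cos_arccos (by linarith) hq1, hq]; field_simp
    have hs : √(1 - 2*ε) * Real.sin (Real.arccos q) = √2 * √(1/2 - 2*ε) := by
      rw [Real.sin_arccos, ← Real.sqrt_mul (by linarith), ← Real.sqrt_mul (by norm_num)]
      congr 1
      rw [hqd, Real.sq_sqrt (div_nonneg h1.le (by linarith))]
      have : 1/2 - ε ≠ 0 := by linarith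
      have : 1 - 2*ε ≠ 0 := by linarith
      field_simp
      ring
    have i1 := flux_aux (√(1 - 2*ε)) (Real.arccos q) hb.le (Real.arccos_nonneg _) (Real.arccos_le_pi _)
    have i2 := flux_aux (√(1 - 2*ε)) (π - Real.arccos q) hb.le
      (by linarith [Real.arccos_le_pi q]) (by linarith [Real.arccos_nonneg q])
    rw [Real.cos_pi_sub, Real.sin_pi_sub, mul_neg, ← hab] at i2
    rw [← hab] at i1
    unfold totalFlux
    rw [i1, i2, ← mul_add]
    have : √(1 - 2*ε) * (Real.cos (Real.arccos q) * (2*π - 2*Real.arccos q) + 2 * Real.sin (Real.arccos q))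
      + √(1 - 2*ε) * (-Real.cos (Real.arccos q) * (2*π - 2*(π - Real.arccos q)) + 2 * Real.sin (Real.arccos q))
      = √2 * (4 * (√(1/2 - 2*ε) + √ε * Real.arcsin q)) := by
      rw [Real.arcsin_eq_pi_div_two_sub_arccos]
      linear_combination 4 * hs - (2*π - 4*Real.arccos q) * hab + (2*π - 4*Real.arccos q) * ha
    rw [this]
    field_simp
  · intro h
    have hba : √(1 - 2*ε) ≤ √(2*ε) := Real.sqrt_le_sqrt (by linarith)
    have hb := Real.sqrt_nonneg (1 - 2*ε)
    unfold totalFlux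
    have f1 : ∀ α : ℝ, max 0 (√(2*ε) - √(1 - 2*ε) * Real.cos α) = √(2*ε) - √(1 - 2*ε) * Real.cos α :=
      fun α => max_eq_right (by nlinarith [Real.cos_le_one α])
    have f2 : ∀ α : ℝ, max 0 (-√(2*ε) - √(1 - 2*ε) * Real.cos α) = 0 :=
      fun α => max_eq_left (by nlinarith [Real.neg_one_le_cos α])
    simp only [f1, f2]
    rw [intervalIntegral.integral_sub (by simp)
      ((by fun_prop : Continuous fun α : ℝ => √(1 - 2*ε) * Real.cos α).intervalIntegrable _ _)]
    rw [ha]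
    simp
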